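/- arXiv:1205.2910 — 2 statements merged into one kernel-verified Lean document; each statement's English description precedes it below -/
import Mathlib

section
/- Let P carry a super-Poisson product xy. Define {x,y} := (1/2)(xy − (−1)^{|x||y|} yx) for homogeneous x, y. Then this bracket satisfies the super Jacobi identity: (−1)^{|z||x|}{x,{y,z}} + (−1)^{|x||y|}{y,{z,x}} + (−1)^{|y||z|}{z,{x,y}} = 0 for all homogeneous x, y, z ∈ P. -/
/-- The sign `(-1)^i` for `i : ZMod 2`, valued in the field `K`. -/
def sgn (K : Type*) [Field K] (i : ZMod 2) : K := (-1 : K) ^ i.val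

/-- The left-hand side of the super-Poisson identity
`3(xy)z − 3x(yz) + (−1)^{|x||y|}(yx)z − (−1)^{|y||z|}(xz)y − (−1)^{|x||y|+|x||z|}(yz)x
  + (−1)^{|x||z|+|y||z|}(zx)y` for homogeneous `x, y, z` of degrees `i, j, k`. -/
def spId (K : Type*) {V : Type*} [Field K] [AddCommGroup V] [Module K V]
    (mul : V → V → V) (i j k : ZMod 2) (x y z : V) : V :=
  (3 : K) • mul (mul x y) z - (3 : K) • mul x (mul y z)
    + sgn K (i * j) • mul (mul y x) z - sgn K (j * k) • mul (mul x z) y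
    - sgn K (i * j + i * k) • mul (mul y z) x + sgn K (i * k + j * k) • mul (mul z x) y

/-- A product on a `ZMod 2`-graded space is a super-Poisson product if the
super-Poisson identity holds for all homogeneous elements. -/
def IsSuperPoisson (K : Type*) {V : Type*} [Field K] [AddCommGroup V] [Module K V]
    (P : ZMod 2 → Submodule K V) (mul : V → V → V) : Prop :=
  ∀ i j k : ZMod 2, ∀ x ∈ P i, ∀ y ∈ P j, ∀ z ∈ P k, spId K mul i j k x y z = 0

/-- The associator `A(x,y,z) = (xy)z − x(yz)`. -/
def assocr {V : Type*} [AddCommGroup V] (mul : V → V → V) (x y z : V) : V :=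
  mul (mul x y) z - mul x (mul y z)

/-- The supersymmetrized product `x∘y = (1/2)(xy + (−1)^{|x||y|} yx)` on homogeneous
elements of degrees `i, j`. -/
def scirc (K : Type*) {V : Type*} [Field K] [AddCommGroup V] [Module K V]
    (mul : V → V → V) (i j : ZMod 2) (x y : V) : V :=
  (2 : K)⁻¹ • (mul x y + sgn K (i * j) • mul y x)

/-- The super bracket `{x,y} = (1/2)(xy − (−1)^{|x||y|} yx)` on homogeneous
elements of degrees `i, j`. -/
def sbr (K : Type*) {V : Type*} [Field K] [AddCommGroup V] [Module K V]
    (mul : V → V → V) (i j : ZMod 2) (x y : V) : V :=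
  (2 : K)⁻¹ • (mul x y - sgn K (i * j) • mul y x)

theorem sgn_add (K : Type*) [Field K] (a b : ZMod 2) : sgn K (a + b) = sgn K a * sgn K b := by
  rw [sgn, sgn, sgn, ZMod.val_add, ← neg_one_pow_eq_pow_mod_two, pow_add]

theorem sgn_eq_one_or_neg_one (K : Type*) [Field K] (a : ZMod 2) : sgn K a = 1 ∨ sgn K a = -1 :=
  neg_one_pow_eq_or K a.val

/-- For a super-Poisson product, the bracket
`{x,y} := (1/2)(xy − (−1)^{|x||y|} yx)` satisfies the super Jacobi identity. -/
theorem superPoisson_sbr_jacobi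
    (K V : Type*) [Field K] [CharZero K] [AddCommGroup V] [Module K V]
    (P : ZMod 2 → Submodule K V) (hP : DirectSum.IsInternal P)
    (mul : V →ₗ[K] V →ₗ[K] V)
    (hgr : ∀ i j : ZMod 2, ∀ x ∈ P i, ∀ y ∈ P j, mul x y ∈ P (i + j))
    (hSP : IsSuperPoisson K P (fun u v => mul u v)) :
    ∀ i j k : ZMod 2, ∀ x ∈ P i, ∀ y ∈ P j, ∀ z ∈ P k,
      sgn K (k * i) • sbr K (fun u v => mul u v) i (j + k) x (sbr K (fun u v => mul u v) j k y z)
        + sgn K (i * j) • sbr K (fun u v => mul u v) j (k + i) y (sbr K (fun u v => mul u v) k i z x)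
        + sgn K (j * k) • sbr K (fun u v => mul u v) k (i + j) z (sbr K (fun u v => mul u v) i j x y)
        = 0 := by
  intro i j k x hx y hy z hz
  have hxyz := hSP i j k x hx y hy z hz
  have hxzy := hSP i k j x hx z hz y hy
  have hyzx := hSP j k i y hy z hz x hx
  have hyxz := hSP j i k y hy x hx z hz
  have hzxy := hSP k i j z hz x hx y hy
  have hzyx := hSP k j i z hz y hy x hx
  simp only [spId, sbr, mul_add, sgn_add, map_smul, map_sub, LinearMap.smul_apply,
    LinearMap.sub_apply, mul_comm j i, mul_comm k i, mul_comm k j]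
    at hxyz hxzy hyzx hyxz hzxy hzyx ⊢
  have hs := sgn_eq_one_or_neg_one K (i * j)
  have ht := sgn_eq_one_or_neg_one K (j * k)
  have hu := sgn_eq_one_or_neg_one K (i * k)
  generalize sgn K (i * j) = s at *
  generalize sgn K (j * k) = t at *
  generalize sgn K (i * k) = u at *
  linear_combination (norm := skip) (-u / 12) • hxyz + (u * t / 12) • hxzy - (s / 12) • hyzx
    + (s * u / 12) • hyxz - (t / 12) • hzxy + (s * t / 12) • hzyx
  obtain rfl | rfl := hs <;> obtain rfl | rfl := ht <;> obtain rfl | rfl := hu <;> module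
end

section
/- Let P = K² be the 2-dimensional Z₂-graded K-vector space with P₀ = span(e₀) and P₁ = span(e₁). Each of the following graded bilinear products (all unspecified products of basis vectors being zero) is a super-Poisson product: (i) e₀e₀ = a e₀; (ii) e₀e₀ = a e₀, e₀e₁ = e₁e₀ = a e₁; (iii) e₀e₁ = b e₁, e₁e₀ = −b e₁; (iv) e₁e₁ = d e₀; where a, b, d ∈ K. -/
/-- The grading of `K²` with even part spanned by `e₀ = (1,0)` and odd part spanned
by `e₁ = (0,1)`. -/
def P2 (K : Type*) [Field K] : ZMod 2 → Submodule K (K × K) := fun i =>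
  if i = 0 then Submodule.span K {((1 : K), (0 : K))} else Submodule.span K {((0 : K), (1 : K))}

/-- The bilinear product on `K²` determined by `e₀e₀ = a e₀`, `e₀e₁ = b e₁`,
`e₁e₀ = c e₁`, `e₁e₁ = d e₀`. -/
def mul2 {K : Type*} [Field K] (a b c d : K) : K × K → K × K → K × K :=
  fun u v => (a * u.1 * v.1 + d * u.2 * v.2, b * u.1 * v.2 + c * u.2 * v.1)

theorem eq_zero_or_eq_one (i : ZMod 2) : i = 0 ∨ i = 1 := by
  decide +revert

@[simp]
theorem sgn_zero (K : Type*) [Field K] : sgn K 0 = 1 := by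
  simp [sgn]

@[simp]
theorem sgn_one (K : Type*) [Field K] : sgn K 1 = -1 := by
  simp [sgn, ZMod.val_one]

/-- The homogeneous element of degree `i` of `K²` with coordinate `r`. -/
def homogeneous {K : Type*} [Field K] (i : ZMod 2) (r : K) : K × K :=
  if i = 0 then (r, 0) else (0, r)

theorem exists_eq_homogeneous {K : Type*} [Field K] {i : ZMod 2} {x : K × K} (hx : x ∈ P2 K i) :
    ∃ r, x = homogeneous i r := by
  unfold P2 at hx
  split_ifs at hx with h <;> obtain ⟨r, rfl⟩ := Submodule.mem_span_singleton.1 hx <;>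
    exact ⟨r, by simp [homogeneous, h]⟩

theorem isSuperPoisson_of_homogeneous {K : Type*} [Field K] {mul : K × K → K × K → K × K}
    (h : ∀ i j k : ZMod 2, ∀ x y z : K,
      spId K mul i j k (homogeneous i x) (homogeneous j y) (homogeneous k z) = 0) :
    IsSuperPoisson K (P2 K) mul := by
  intro i j k x hx y hy z hz
  obtain ⟨x, rfl⟩ := exists_eq_homogeneous hx
  obtain ⟨y, rfl⟩ := exists_eq_homogeneous hy
  obtain ⟨z, rfl⟩ := exists_eq_homogeneous hz
  exact h i j k x y z


/-- Each of the following products on `K² = span(e₀) ⊕ span(e₁)`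
(unspecified basis products being zero) is a super-Poisson product:
(i) `e₀e₀ = a e₀`; (ii) `e₀e₀ = a e₀, e₀e₁ = e₁e₀ = a e₁`;
(iii) `e₀e₁ = b e₁, e₁e₀ = −b e₁`; (iv) `e₁e₁ = d e₀`. -/
theorem dim2_superPoisson_examples
    (K : Type*) [Field K] [CharZero K] (a b d : K) :
    IsSuperPoisson K (P2 K) (mul2 a 0 0 0) ∧
    IsSuperPoisson K (P2 K) (mul2 a a a 0) ∧
    IsSuperPoisson K (P2 K) (mul2 0 b (-b) 0) ∧
    IsSuperPoisson K (P2 K) (mul2 0 0 0 d) := by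
  refine ⟨isSuperPoisson_of_homogeneous fun i j k => ?_, isSuperPoisson_of_homogeneous fun i j k => ?_,
    isSuperPoisson_of_homogeneous fun i j k => ?_, isSuperPoisson_of_homogeneous fun i j k => ?_⟩ <;>
  · intro x y z
    rcases eq_zero_or_eq_one i with rfl | rfl <;> rcases eq_zero_or_eq_one j with rfl | rfl <;>
      rcases eq_zero_or_eq_one k with rfl | rfl <;>
      simp [homogeneous, spId, mul2, CharTwo.add_self_eq_zero] <;> ring
end
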